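/- arXiv:1409.4242 — 3 statements merged into one kernel-verified Lean document; each statement's English description precedes it below -/
import Mathlib

section
/- Let η, δ, ε > 0 and Q_0 ∈ Δ, and suppose that (Q_0 ∩ K) ∖ (Σ(cδ^n) ∪ Λ(η)) has positive μ-measure, where c > 0 is the constant of the SI-volume bound, Σ(cδ^n) = ⋃_{Q ∈ SI(cδ^n, Q_0)} Q and Λ(η) = K ∩ ⋃_{Q ∈ LD(η, Q_0)} Q. Then there exists C > 0 depending only on δ, η, n and the constants of K and the cube system such that there exist finitely many compact sets F_1, …, F_M ⊆ Q_0 ∩ K with φ|_{F_j} biLipschitz for each j and μ((Q_0 ∩ K) ∖ ⋃_j F_j) ≤ ε + η μ(Q_0) + C μ(Q_0 ∖ DC(δ, 1/10, 16·ℓ(Q_0))). -/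
open MeasureTheory Metric Set Filter ENNReal NNReal Topology

noncomputable section

/-- A system of "dyadic cubes" adapted to a compact set `K` of a metric measure space, as in
Christ's construction: `cubes k` is the (countable) family of cubes of generation `k ≤ kK`. -/
structure CubeSystem (X : Type) [MetricSpace X] [MeasurableSpace X]
    (μ : Measure X) (K : Set X) (n : ℕ) (C RK a η₀ : ℝ) : Type where
  kK : ℤ
  size : (16 : ℝ) ^ (kK + 2) ≤ RK
  cubes : ℤ → Set (Set X)
  countable : ∀ k : ℤ, (cubes k).Countable
  cover : ∀ k : ℤ, k ≤ kK → μ (K \ ⋃₀ cubes k) = 0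
  nested : ∀ k j : ℤ, k ≤ j → j ≤ kK →
    ∀ Q ∈ cubes k, ∀ Q' ∈ cubes j, Q ⊆ Q' ∨ Q ∩ Q' = ∅
  ancestor : ∀ j : ℤ, j ≤ kK → ∀ Q ∈ cubes j, ∀ k : ℤ, j ≤ k → k ≤ kK →
    ∃! Q', Q' ∈ cubes k ∧ Q ⊆ Q'
  ball : ∀ k : ℤ, k ≤ kK → ∀ Q ∈ cubes k, ∃ z ∈ K,
    closedBall z ((16 : ℝ) ^ (k - 1)) ⊆ Q ∧ Q ⊆ closedBall z ((16 : ℝ) ^ (k + 1))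
  smallBoundary : ∀ k : ℤ, k ≤ kK → ∀ Q ∈ cubes k, ∀ t : ℝ, 0 < t →
    μ {x | x ∈ Q ∩ K ∧ infDist x Qᶜ ≤ t * (16 : ℝ) ^ k} ≤
      ENNReal.ofReal (a * t ^ η₀) * μ Q
  growth : ∀ k : ℤ, k ≤ kK → ∀ Q ∈ cubes k,
    ENNReal.ofReal (C⁻¹ * (16 : ℝ) ^ ((k - 1) * (n : ℤ))) ≤ μ Q ∧
      μ Q ≤ ENNReal.ofReal (C * (16 : ℝ) ^ ((k + 1) * (n : ℤ)))

variable {X : Type} [MetricSpace X] [MeasurableSpace X]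
  {μ : Measure X} {K : Set X} {n : ℕ} {C RK a η₀ : ℝ}

/-- Membership in the cube system `Δ`. -/
def IsCube (D : CubeSystem X μ K n C RK a η₀) (Q : Set X) : Prop :=
  ∃ k : ℤ, k ≤ D.kK ∧ Q ∈ D.cubes k

/-- `j(Q)`: the largest generation to which a cube belongs. -/
def lvl (D : CubeSystem X μ K n C RK a η₀) (Q : Set X) : ℤ :=
  sSup {k : ℤ | k ≤ D.kK ∧ Q ∈ D.cubes k}

/-- `ℓ(Q) = 16 ^ j(Q)`. -/
def sidelength (D : CubeSystem X μ K n C RK a η₀) (Q : Set X) : ℝ :=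
  (16 : ℝ) ^ lvl D Q

/-- The distance between two sets. -/
def setDist (s t : Set X) : ℝ :=
  sInf (Set.image2 dist s t)

/-- The dilate `λQ = {x : dist(x, Q) ≤ (λ - 1) diam Q}`. -/
def dilate (Q : Set X) (l : ℝ) : Set X :=
  {x | infDist x Q ≤ (l - 1) * Metric.diam Q}

/-- Two cubes are `A`-neighbours. -/
def ANeighbor (A : ℝ) (Q Q' : Set X) : Prop :=
  setDist Q Q' ≤ A * (Metric.diam Q + Metric.diam Q') ∧
  A⁻¹ * Metric.diam Q ≤ Metric.diam Q' ∧ Metric.diam Q' ≤ A * Metric.diam Q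

/-- `Q̂`: the union of the cubes of generation `j(Q)` within `diam Q` of `Q`, intersected
with `Q₀`. -/
def hat (D : CubeSystem X μ K n C RK a η₀) (Q₀ Q : Set X) : Set X :=
  (⋃₀ {S | S ∈ D.cubes (lvl D Q) ∧ setDist S Q ≤ Metric.diam Q}) ∩ Q₀

/-- The set `DC(β, ε, R)`, relative to `K` and the chart `φ`. -/
def DCset (K : Set X) (φ : X → EuclideanSpace ℝ (Fin n)) (β ε R : ℝ) : Set X :=
  {x | x ∈ K ∧ ∀ r : ℝ, 0 < r → r < R →
    ENNReal.ofReal (1 - ε) * μH[n] (closedBall (φ x) (β * r)) ≤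
      μH[n] (closedBall (φ x) (β * r) ∩ φ '' (closedBall x r ∩ K))}

/-- The family `SI(δ, Q₀)` of cubes contained in a cube of small image. -/
def SIset (D : CubeSystem X μ K n C RK a η₀) (φ : X → EuclideanSpace ℝ (Fin n))
    (δ : ℝ) (Q₀ : Set X) : Set (Set X) :=
  {Q | IsCube D Q ∧ Q ⊆ Q₀ ∧ ∃ W, IsCube D W ∧ W ⊆ Q₀ ∧ Q ⊆ W ∧
    μH[n] (φ '' (W ∩ K)) < ENNReal.ofReal δ * μ W}

/-- The family `LD(η, Q₀)` of cubes contained in a cube of low density. -/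
def LDset (D : CubeSystem X μ K n C RK a η₀) (η : ℝ) (Q₀ : Set X) : Set (Set X) :=
  {Q | IsCube D Q ∧ Q ⊆ Q₀ ∧ ∃ W, IsCube D W ∧ W ⊆ Q₀ ∧ Q ⊆ W ∧
    μ (W ∩ K) < ENNReal.ofReal η * μ W}

/-- The family `M_A(ζ, Q₀)` of cubes whose image measure ratio is nearly preserved by all
`A`-neighbours. -/
def MAset (D : CubeSystem X μ K n C RK a η₀) (φ : X → EuclideanSpace ℝ (Fin n))
    (δ ζ A : ℝ) (Q₀ : Set X) : Set (Set X) :=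
  {Q | IsCube D Q ∧ Q ⊆ Q₀ ∧
    ENNReal.ofReal ((1 + ζ)⁻¹ * δ) * μ Q ≤ μH[n] (φ '' (Q ∩ K)) ∧
    (∀ R, IsCube D R → ANeighbor A Q R →
      R ⊆ Q₀ ∧
      (ENNReal.ofReal (1 + ζ))⁻¹ * (μH[n] (φ '' (Q ∩ K)) / μ Q) ≤
          μH[n] (φ '' (R ∩ K)) / μ R ∧
      μH[n] (φ '' (R ∩ K)) / μ R ≤
          ENNReal.ofReal (1 + ζ) * (μH[n] (φ '' (Q ∩ K)) / μ Q)) ∧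
    (∀ R, IsCube D R → ANeighbor A Q R →
      (ENNReal.ofReal (1 + ζ))⁻¹ * (μH[n] (φ '' (Q ∩ K)) / μ Q) ≤
          μH[n] (φ '' (hat D Q₀ R ∩ K)) / μ (hat D Q₀ R) ∧
      μH[n] (φ '' (hat D Q₀ R ∩ K)) / μ (hat D Q₀ R) ≤
          ENNReal.ofReal (1 + ζ) * (μH[n] (φ '' (Q ∩ K)) / μ Q))}

/-- A family of cubes is a `K`-Carleson set with constant `C'`. -/
def KCarleson (D : CubeSystem X μ K n C RK a η₀) (E : Set (Set X)) (C' : ℝ) : Prop :=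
  ∀ Q₀ : Set X, IsCube D Q₀ →
    (∑' Q : ↥{Q | Q ∈ E ∧ Q ⊆ Q₀}, μ ((Q : Set X) ∩ K)) ≤ ENNReal.ofReal C' * μ Q₀

/-- A stopping time region with top cube `top`. -/
def IsSTRegion (D : CubeSystem X μ K n C RK a η₀) (S : Set (Set X)) (top : Set X) : Prop :=
  top ∈ S ∧ (∀ Q ∈ S, IsCube D Q) ∧ (∀ Q ∈ S, Q ⊆ top) ∧
    ∀ Q ∈ S, ∀ Q', IsCube D Q' → Q ⊆ Q' → Q' ⊆ top → Q' ∈ S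

/-- `Q'` is a child of `Q`: a maximal cube of `Δ` properly contained in `Q`. -/
def IsChild (D : CubeSystem X μ K n C RK a η₀) (Q' Q : Set X) : Prop :=
  IsCube D Q' ∧ Q' ⊂ Q ∧ ∀ Q'', IsCube D Q'' → Q'' ⊂ Q → Q' ⊆ Q'' → Q'' = Q'

/-- Two-sided `n`-regularity of `μ` on closed balls centred in `K`, at scales below `R`. -/
def BallRegular (μ : Measure X) (K : Set X) (n : ℕ) (C R : ℝ) : Prop :=
  ∀ x ∈ K, ∀ r : ℝ, 0 < r → r < R →
    ENNReal.ofReal (C⁻¹ * r ^ n) ≤ μ (closedBall x r) ∧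
      μ (closedBall x r) ≤ ENNReal.ofReal (C * r ^ n)

theorem hausdorffMeasure_closedBall (x : EuclideanSpace ℝ (Fin n)) {r : ℝ} (hr : 0 ≤ r) :
    μH[n] (closedBall x r) =
      ENNReal.ofReal (r ^ n) * μH[n] (closedBall (0 : EuclideanSpace ℝ (Fin n)) 1) := by
  simpa using Measure.addHaar_closedBall' (μH[n] : Measure (EuclideanSpace ℝ (Fin n))) x hr

theorem hausdorffMeasure_unit_ne_top :
    μH[n] (closedBall (0 : EuclideanSpace ℝ (Fin n)) 1) ≠ ∞ :=
  measure_closedBall_lt_top.ne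

theorem hausdorffMeasure_unit_ne_zero :
    μH[n] (closedBall (0 : EuclideanSpace ℝ (Fin n)) 1) ≠ 0 :=
  (measure_closedBall_pos _ _ one_pos).ne'

/-- A consequence of the Vitali covering lemma: an outer measure dominated by a measure along
one enlarged ball around each point of a set is dominated on the whole set. -/
theorem outerMeasure_le_of_vitali [TopologicalSpace.SeparableSpace X] [BorelSpace X]
    (τ : OuterMeasure X) (ν : Measure X) (A : Set X) (r : X → ℝ) (R : ℝ)
    (hr : ∀ x ∈ A, 0 < r x) (hR : ∀ x ∈ A, r x ≤ R) (c : ℝ≥0∞)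
    (h : ∀ x ∈ A, τ (closedBall x (5 * r x)) ≤ c * ν (closedBall x (r x))) :
    τ A ≤ c * ν univ := by
  obtain ⟨u, huA, hdisj, hcov⟩ :=
    Vitali.exists_disjoint_subfamily_covering_enlargement_closedBall A id r R hR 5 (by norm_num)
  simp only [id] at hdisj hcov
  have hcount : u.Countable := by
    refine hdisj.countable_of_nonempty_interior fun x hx => ⟨x, ?_⟩
    exact ball_subset_interior_closedBall (mem_ball_self (hr x (huA hx)))
  have hsub : A ⊆ ⋃ x ∈ u, closedBall x (5 * r x) := by
    intro x hx
    obtain ⟨b, hb, hxb⟩ := hcov x hx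
    exact mem_biUnion hb (hxb (mem_closedBall_self (hr x hx).le))
  calc τ A ≤ τ (⋃ x ∈ u, closedBall x (5 * r x)) := measure_mono hsub
    _ ≤ ∑' x : u, τ (closedBall (x : X) (5 * r x)) := measure_biUnion_le τ hcount _
    _ ≤ ∑' x : u, c * ν (closedBall (x : X) (r x)) :=
        ENNReal.tsum_le_tsum fun x => h x (huA x.2)
    _ = c * ∑' x : u, ν (closedBall (x : X) (r x)) := ENNReal.tsum_mul_left
    _ = c * ν (⋃ x ∈ u, closedBall x (r x)) := by
        rw [measure_biUnion hcount hdisj fun _ _ => isClosed_closedBall.measurableSet]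
    _ ≤ c * ν univ := by gcongr; exact subset_univ _

/-- A `1`-Lipschitz chart increases the measure of subsets of `K` at most by a fixed factor. -/
theorem exists_hausdorffMeasure_image_le [TopologicalSpace.SeparableSpace X] [BorelSpace X]
    [IsFiniteMeasure μ] (hC : 0 < C) (hRK : 0 < RK) (hreg : BallRegular μ K n C RK)
    {φ : X → EuclideanSpace ℝ (Fin n)} (hφ : LipschitzWith 1 φ) :
    ∃ c : ℝ≥0∞, c ≠ ∞ ∧ ∀ E ⊆ K, μH[n] (φ '' E) ≤ c * μ E := by
  set ω := μH[n] (closedBall (0 : EuclideanSpace ℝ (Fin n)) 1) with hω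
  have hct : ENNReal.ofReal (5 ^ n * C) * ω ≠ ∞ :=
    ENNReal.mul_ne_top ENNReal.ofReal_ne_top hausdorffMeasure_unit_ne_top
  refine ⟨ENNReal.ofReal (5 ^ n * C) * ω, hct, ?_⟩
  intro E hE
  have key : ∀ U : Set X, E ⊆ U → IsOpen U →
      μH[n] (φ '' E) ≤ ENNReal.ofReal (5 ^ n * C) * ω * μ U := by
    intro U hEU hU
    have hex : ∀ x : X, ∃ r : ℝ, x ∈ E → 0 < r ∧ r < RK ∧ closedBall x r ⊆ U := by
      intro x
      by_cases hx : x ∈ E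
      · obtain ⟨s, hs, hsU⟩ := nhds_basis_closedBall.mem_iff.1 (hU.mem_nhds (hEU hx))
        refine ⟨min s (RK / 2), fun _ => ⟨by positivity, ?_, ?_⟩⟩
        · exact (min_le_right _ _).trans_lt (by linarith)
        · exact (closedBall_subset_closedBall (min_le_left _ _)).trans hsU
      · exact ⟨0, fun h => absurd h hx⟩
    choose r hr using hex
    have := outerMeasure_le_of_vitali
      (OuterMeasure.comap φ (μH[n] : Measure (EuclideanSpace ℝ (Fin n))).toOuterMeasure)
      (μ.restrict U) E r RK (fun x hx => (hr x hx).1) (fun x hx => (hr x hx).2.1.le)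
      (ENNReal.ofReal (5 ^ n * C) * ω) ?_
    · simpa using this
    · intro x hx
      obtain ⟨h0, h1, h2⟩ := hr x hx
      rw [Measure.restrict_eq_self _ h2]
      have him : φ '' closedBall x (5 * r x) ⊆ closedBall (φ x) (5 * r x) := by
        simpa using (hφ.mapsTo_closedBall x (5 * r x)).image_subset
      calc _ ≤ μH[n] (closedBall (φ x) (5 * r x)) := by
              simpa using measure_mono him
        _ = ENNReal.ofReal ((5 * r x) ^ n) * ω := hausdorffMeasure_closedBall _ (by positivity)
        _ = ENNReal.ofReal (5 ^ n * C) * ω * ENNReal.ofReal (C⁻¹ * r x ^ n) := by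
              rw [mul_right_comm, ← ENNReal.ofReal_mul (by positivity)]
              congr 2
              field_simp
              ring
        _ ≤ _ := by gcongr; exact (hreg x (hE hx) _ h0 h1).1
  have hlim : Tendsto (fun s : ℝ≥0∞ => ENNReal.ofReal (5 ^ n * C) * ω * (μ E + s)) (𝓝 0)
      (𝓝 (ENNReal.ofReal (5 ^ n * C) * ω * (μ E + 0))) :=
    ENNReal.Tendsto.const_mul (tendsto_const_nhds.add tendsto_id) (Or.inr hct)
  rw [add_zero] at hlim
  refine ge_of_tendsto (hlim.mono_left (nhdsWithin_le_nhds (s := Ioi 0))) ?_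
  filter_upwards [self_mem_nhdsWithin] with s hs
  obtain ⟨U, hEU, hU, hμ⟩ := E.exists_isOpen_le_add μ (ne_of_gt hs)
  exact (key U hEU hU).trans (by gcongr)

/-- Almost every point of `K` outside a measurable set `S` is a point of zero `n`-density
for `S`. -/
theorem measure_not_eventually_small_density [TopologicalSpace.SeparableSpace X] [BorelSpace X]
    [IsFiniteMeasure μ] (hC : 0 < C) (hRK : 0 < RK) (hreg : BallRegular μ K n C RK)
    {S : Set X} (hS : MeasurableSet S) {t : ℝ≥0∞} (ht : t ≠ 0) :
    μ {x ∈ K \ S | ¬ ∀ᶠ r in 𝓝[>] (0 : ℝ),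
      μ (S ∩ closedBall x r) < t * ENNReal.ofReal (r ^ n)} = 0 := by
  wlog htt : t ≠ ∞ generalizing t
  · refine measure_mono_null ?_ (this (t := 1) one_ne_zero one_ne_top)
    rintro x ⟨hx, h⟩
    refine ⟨hx, fun h' => h ?_⟩
    filter_upwards [h'] with r hr
    refine hr.trans_le ?_
    gcongr
    rw [not_not] at htt
    simp [htt]
  set A := {x ∈ K \ S | ¬ ∀ᶠ r in 𝓝[>] (0 : ℝ),
      μ (S ∩ closedBall x r) < t * ENNReal.ofReal (r ^ n)} with hA
  set c : ℝ≥0∞ := ENNReal.ofReal (5 ^ n * C) / t with hc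
  have hct : c ≠ ∞ := ENNReal.div_ne_top ENNReal.ofReal_ne_top ht
  have key : ∀ s : ℝ≥0∞, 0 < s → μ A ≤ c * s := by
    intro s hs
    obtain ⟨F, hFS, hF, hμF⟩ := hS.exists_isClosed_sdiff_lt (measure_ne_top μ S) hs.ne'
    have hex : ∀ x : X, ∃ r : ℝ, x ∈ A → 0 < r ∧ 5 * r < RK ∧ closedBall x r ⊆ Fᶜ ∧
        t * ENNReal.ofReal (r ^ n) ≤ μ (S ∩ closedBall x r) := by
      intro x
      by_cases hx : x ∈ A
      · obtain ⟨q, hq, hqF⟩ := nhds_basis_closedBall.mem_iff.1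
          (hF.isOpen_compl.mem_nhds fun h => hx.1.2 (hFS h))
        have hfr := Filter.not_eventually.1 hx.2
        have hev : ∀ᶠ r in 𝓝[>] (0 : ℝ), r ∈ Ioo 0 (min q (RK / 5)) :=
          Ioo_mem_nhdsGT (by positivity)
        obtain ⟨r, hr, hr0, hr1⟩ := (hfr.and_eventually hev).exists
        refine ⟨r, fun _ => ⟨hr0, ?_, ?_, not_lt.1 hr⟩⟩
        · linarith [hr1.trans_le (min_le_right _ _)]
        · exact (closedBall_subset_closedBall (hr1.trans_le (min_le_left _ _)).le).trans hqF
      · exact ⟨0, fun h => absurd h hx⟩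
    choose r hr using hex
    have := outerMeasure_le_of_vitali μ.toOuterMeasure (μ.restrict (S \ F)) A r RK
      (fun x hx => (hr x hx).1) (fun x hx => by linarith [(hr x hx).1, (hr x hx).2.1]) c ?_
    · refine this.trans ?_
      gcongr
      simpa using hμF.le
    · intro x hx
      obtain ⟨h0, h1, h2, h3⟩ := hr x hx
      rw [Measure.restrict_apply isClosed_closedBall.measurableSet]
      have hinter : closedBall x (r x) ∩ (S \ F) = S ∩ closedBall x (r x) := by
        ext y
        exact ⟨fun h => ⟨h.2.1, h.1⟩, fun h => ⟨h.2, h.1, h2 h.2⟩⟩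
      rw [hinter]
      calc μ (closedBall x (5 * r x)) ≤ ENNReal.ofReal (C * (5 * r x) ^ n) :=
            (hreg x hx.1.1 _ (by positivity) h1).2
        _ = c * (t * ENNReal.ofReal (r x ^ n)) := by
            rw [hc, ← mul_assoc, ENNReal.div_mul_cancel ht htt,
              ← ENNReal.ofReal_mul (by positivity)]
            congr 1
            ring
        _ ≤ _ := by gcongr
  have hlim : Tendsto (fun s : ℝ≥0∞ => c * s) (𝓝[>] 0) (𝓝 (c * 0)) :=
    (ENNReal.Tendsto.const_mul tendsto_id (Or.inr hct)).mono_left nhdsWithin_le_nhds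
  rw [mul_zero] at hlim
  refine le_antisymm (ge_of_tendsto hlim ?_) zero_le
  filter_upwards [self_mem_nhdsWithin] with s hs using key s hs

/-- At almost every point of `K` outside a measurable set `S ⊆ K`, the image of `S` has small
`n`-density. -/
theorem measure_not_eventually_small_image [TopologicalSpace.SeparableSpace X] [BorelSpace X]
    [IsFiniteMeasure μ] (hC : 0 < C) (hRK : 0 < RK) (hreg : BallRegular μ K n C RK)
    {φ : X → EuclideanSpace ℝ (Fin n)} (hφ : LipschitzWith 1 φ)
    {S : Set X} (hSK : S ⊆ K) (hS : MeasurableSet S) {θ : ℝ≥0∞} (hθ : θ ≠ 0) :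
    μ {x ∈ K \ S | ¬ ∀ᶠ r in 𝓝[>] (0 : ℝ),
      μH[n] (φ '' (S ∩ closedBall x r)) ≤ θ * ENNReal.ofReal (r ^ n)} = 0 := by
  obtain ⟨c, hc, himg⟩ := exists_hausdorffMeasure_image_le hC hRK hreg hφ
  have hct : c + 1 ≠ ∞ := by simp [hc]
  refine measure_mono_null ?_ (measure_not_eventually_small_density hC hRK hreg hS
    (t := θ / (c + 1)) (ENNReal.div_ne_zero.2 ⟨hθ, hct⟩))
  rintro x ⟨hx, h⟩
  refine ⟨hx, fun h' => h ?_⟩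
  filter_upwards [h'] with r hr
  calc μH[n] (φ '' (S ∩ closedBall x r)) ≤ c * μ (S ∩ closedBall x r) :=
        himg _ (inter_subset_left.trans hSK)
    _ ≤ (c + 1) * (θ / (c + 1) * ENNReal.ofReal (r ^ n)) := by
        gcongr
        exact le_self_add
    _ = θ * ENNReal.ofReal (r ^ n) := by
        rw [← mul_assoc, ENNReal.mul_div_cancel (by simp) hct]

/-- The points of `K` sharing their image with another point of `K` at distance at most `s`. -/
def collapseSet (K : Set X) (φ : X → EuclideanSpace ℝ (Fin n)) (s : ℝ) : Set X :=
  {u | u ∈ K ∧ ∃ v ∈ K, u ≠ v ∧ dist u v ≤ s ∧ φ u = φ v}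

theorem measurableSet_collapseSet [BorelSpace X] (hK : IsCompact K)
    {φ : X → EuclideanSpace ℝ (Fin n)} (hφ : Continuous φ) (s : ℝ) :
    MeasurableSet (collapseSet K φ s) := by
  have heq : collapseSet K φ s = ⋃ k : ℕ, Prod.fst '' ((K ×ˢ K) ∩
      {p : X × X | 1 / ((k : ℝ) + 1) ≤ dist p.1 p.2 ∧ dist p.1 p.2 ≤ s ∧ φ p.1 = φ p.2}) := by
    ext u
    simp only [collapseSet, mem_ofPred_eq, mem_iUnion, mem_image, mem_inter_iff, mem_prod,
      Prod.exists, exists_and_right, exists_eq_right]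
    constructor
    · rintro ⟨hu, v, hv, huv, hd, hφuv⟩
      obtain ⟨k, hk⟩ := exists_nat_one_div_lt (dist_pos.2 huv)
      exact ⟨k, v, ⟨hu, hv⟩, hk.le, hd, hφuv⟩
    · rintro ⟨k, v, ⟨hu, hv⟩, hk, hd, hφuv⟩
      refine ⟨hu, v, hv, dist_pos.1 (lt_of_lt_of_le ?_ hk), hd, hφuv⟩
      positivity
  rw [heq]
  refine MeasurableSet.iUnion fun k => ?_
  refine IsCompact.measurableSet (IsCompact.image ?_ continuous_fst)
  refine (hK.prod hK).inter_right ?_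
  exact (isClosed_le continuous_const continuous_dist).inter
    ((isClosed_le continuous_dist continuous_const).inter
      (isClosed_eq (hφ.comp continuous_fst) (hφ.comp continuous_snd)))

theorem infinite_fiber_of_mem_iInter_collapseSet {Y : Type} [MetricSpace Y] {K : Set Y}
    {φ : Y → EuclideanSpace ℝ (Fin n)} {x : Y}
    (hx : x ∈ ⋂ m : ℕ, collapseSet K φ (1 / ((m : ℝ) + 1))) :
    {v | v ∈ K ∧ φ v = φ x}.Infinite := by
  intro hfin
  have hcl : IsClosed ({v | v ∈ K ∧ φ v = φ x} \ {x}) := (hfin.subset sdiff_subset).isClosed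
  obtain ⟨s, hs, hsub⟩ := Metric.isOpen_iff.1 hcl.isOpen_compl x (by simp)
  obtain ⟨m, hm⟩ := exists_nat_one_div_lt hs
  obtain ⟨-, v, hv, hne, hd, hφv⟩ := mem_iInter.1 hx m
  exact hsub (mem_ball'.2 (hd.trans_lt hm)) ⟨⟨hv, hφv.symm⟩, fun h => hne (Eq.symm h)⟩

/-- Almost every point of the image has a finite fibre, so that the points of `K` which are
limits of other points of their fibre have a null image. -/
theorem hausdorffMeasure_image_iInter_collapseSet [TopologicalSpace.SeparableSpace X]
    [BorelSpace X] [IsFiniteMeasure μ] (hKm : MeasurableSet K)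
    {φ : X → EuclideanSpace ℝ (Fin n)} {c : ℝ≥0∞} (hc : c ≠ ∞)
    (himg : ∀ E ⊆ K, μH[n] (φ '' E) ≤ c * μ E) :
    μH[n] (φ '' ⋂ m : ℕ, collapseSet K φ (1 / ((m : ℝ) + 1))) = 0 := by
  choose P hPm hPb hPd hPu hPdisj using fun k : ℕ =>
    SeparableSpace.exists_measurable_partition_diam_le X
      (show (0 : ℝ) < 1 / ((k : ℝ) + 1) by positivity)
  let H : Measure (EuclideanSpace ℝ (Fin n)) := μH[n]
  let g : ℕ → ℕ → Set (EuclideanSpace ℝ (Fin n)) := fun k i => toMeasurable H (φ '' (P k i ∩ K))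
  have hg : ∀ k i, MeasurableSet (g k i) := fun k i => measurableSet_toMeasurable _ _
  let f : ℕ → EuclideanSpace ℝ (Fin n) → ℝ≥0∞ := fun k p => ∑' i, (g k i).indicator 1 p
  have hfm : ∀ k, Measurable (f k) := fun k =>
    Measurable.tsum fun i => measurable_one.indicator (hg k i)
  have hfi : ∀ k, ∫⁻ p, f k p ∂H ≤ c * μ univ := by
    intro k
    calc ∫⁻ p, f k p ∂H = ∑' i, ∫⁻ p, (g k i).indicator 1 p ∂H :=
          lintegral_tsum fun i => (measurable_one.indicator (hg k i)).aemeasurable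
      _ = ∑' i, H (φ '' (P k i ∩ K)) := by
          refine tsum_congr fun i => ?_
          rw [lintegral_indicator_one (hg k i), measure_toMeasurable]
      _ ≤ ∑' i, c * μ (P k i ∩ K) :=
          ENNReal.tsum_le_tsum fun i => himg _ inter_subset_right
      _ = c * μ (⋃ i, P k i ∩ K) := by
          rw [ENNReal.tsum_mul_left, measure_iUnion
            (fun i j hij => (hPdisj k hij).mono inter_subset_left inter_subset_left)
            fun i => (hPm k i).inter hKm]
      _ ≤ c * μ univ := by gcongr; exact subset_univ _
  have hlim : ∫⁻ p, liminf (fun k => f k p) atTop ∂H ≠ ∞ := by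
    refine ne_top_of_le_ne_top (ENNReal.mul_ne_top hc (measure_ne_top μ univ))
      ((lintegral_liminf_le hfm).trans ?_)
    exact (liminf_le_liminf (Eventually.of_forall hfi)).trans (by simp)
  have hae := ae_lt_top (Measurable.liminf hfm) hlim
  refine measure_mono_null ?_ (ae_iff.1 hae)
  rintro _ ⟨x, hx, rfl⟩
  simp only [mem_ofPred_eq, not_lt, top_le_iff]
  refine ENNReal.eq_top_of_forall_nnreal_le fun q => ?_
  obtain ⟨L, hL⟩ := exists_nat_ge q
  obtain ⟨T, hT, hTc⟩ := (infinite_fiber_of_mem_iInter_collapseSet hx).exists_subset_card_eq L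
  have hsep : ∀ᶠ k : ℕ in atTop, ∀ u ∈ T, ∀ v ∈ T, u ≠ v → 1 / ((k : ℝ) + 1) < dist u v := by
    rw [Finset.eventually_all]
    intro u _
    rw [Finset.eventually_all]
    intro v _
    by_cases huv : u = v
    · simp [huv]
    · filter_upwards [tendsto_one_div_add_atTop_nhds_zero_nat.eventually_lt_const
        (dist_pos.2 huv)] with k hk _ using hk
  refine le_liminf_of_le (by isBoundedDefault) ?_
  filter_upwards [hsep] with k hk
  have hex : ∀ u : X, ∃ i, u ∈ P k i := fun u => mem_iUnion.1 (hPu k ▸ mem_univ u)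
  choose i hi using hex
  have hinj : Set.InjOn i T := by
    intro u hu v hv huv
    by_contra hne
    refine absurd (hk u hu v hv hne) (not_lt.2 ?_)
    exact (dist_le_diam_of_mem (hPb k (i u)) (hi u) (huv ▸ hi v)).trans (hPd k _)
  calc (q : ℝ≥0∞) ≤ L := by exact_mod_cast hL
    _ = ∑ j ∈ T.image i, (1 : ℝ≥0∞) := by
        rw [Finset.sum_const, Finset.card_image_of_injOn hinj, hTc]
        simp
    _ = ∑ j ∈ T.image i, (g k j).indicator 1 (φ x) := by
        refine Finset.sum_congr rfl fun j hj => ?_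
        obtain ⟨u, hu, rfl⟩ := Finset.mem_image.1 hj
        have hmem : φ x ∈ g k (i u) :=
          subset_toMeasurable _ _ ⟨u, ⟨hi u, (hT hu).1⟩, (hT hu).2⟩
        rw [indicator_of_mem hmem, Pi.one_apply]
    _ ≤ f k (φ x) := ENNReal.sum_le_tsum _

/-- At a point of `DC(δ, 1/10, R)` where the points collapsed at scale `s` have an image of small
density, the chart is bounded below on `DC(δ, 1/10, R)`: otherwise the images of two disjoint
balls would overlap in most of a ball. -/
theorem exists_dist_le_of_mem_DCset [BorelSpace X] (hK : IsCompact K)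
    {φ : X → EuclideanSpace ℝ (Fin n)} (hφ : Continuous φ) {δ R s : ℝ} (hδ : 0 < δ) (hR : 0 < R)
    (hs : 0 < s) {x : X} (hx : x ∈ DCset K φ δ (1 / 10) R)
    (hsmall : ∀ᶠ r in 𝓝[>] (0 : ℝ), μH[n] (φ '' (collapseSet K φ s ∩ closedBall x r)) ≤
      ENNReal.ofReal (1 / 10 * δ ^ n) * μH[n] (closedBall (0 : EuclideanSpace ℝ (Fin n)) 1) *
        ENNReal.ofReal (r ^ n)) :
    ∃ j : ℕ, ∀ y ∈ DCset K φ δ (1 / 10) R, dist x y < 1 / ((j : ℝ) + 1) →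
      1 / ((j : ℝ) + 1) * dist x y ≤ dist (φ x) (φ y) := by
  set ω := μH[n] (closedBall (0 : EuclideanSpace ℝ (Fin n)) 1) with hω
  obtain ⟨r₀, hr₀, hr₀s⟩ := mem_nhdsGT_iff_exists_Ioo_subset.1 hsmall
  have hr₀ : 0 < r₀ := hr₀
  have hlim := tendsto_one_div_add_atTop_nhds_zero_nat (𝕜 := ℝ)
  have hpow : Tendsto (fun j : ℕ => (1 + 3 * (1 / ((j : ℝ) + 1)) / δ) ^ n) atTop (𝓝 1) := by
    simpa using (((hlim.const_mul 3).div_const δ).const_add 1).pow n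
  obtain ⟨j, hj0, hjR, hjs, hjp⟩ := ((hlim.eventually_lt_const hr₀).and
    ((hlim.eventually_lt_const hR).and ((hlim.eventually_lt_const (half_pos hs)).and
      (hpow.eventually_lt_const (show (1 : ℝ) < 11 / 10 by norm_num))))).exists
  refine ⟨j, fun y hy hxy => ?_⟩
  set κ : ℝ := 1 / ((j : ℝ) + 1) with hκ
  have hκ0 : 0 < κ := by positivity
  by_contra! hlt
  have hd : 0 < dist x y := by
    by_contra! h
    have : dist x y = 0 := le_antisymm h dist_nonneg
    rw [this, mul_zero] at hlt
    exact absurd hlt (not_lt.2 dist_nonneg)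
  obtain ⟨r, hr⟩ : ∃ r, dist x y = 3 * r := ⟨dist x y / 3, by ring⟩
  have hr0 : 0 < r := by linarith
  set P := closedBall (φ x) (δ * r) ∩ φ '' (closedBall x r ∩ K) with hP
  set Q := closedBall (φ y) (δ * r) ∩ φ '' (closedBall y r ∩ K) with hQ
  have hball : ∀ z, μH[n] (closedBall (φ z) (δ * r)) = ENNReal.ofReal ((δ * r) ^ n) * ω :=
    fun z => hausdorffMeasure_closedBall _ (by positivity)
  have hPle : ENNReal.ofReal (9 / 10 * (δ * r) ^ n) * ω ≤ μH[n] P := by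
    have := hx.2 r hr0 (by linarith)
    rw [hball, ← mul_assoc, ← ENNReal.ofReal_mul (by norm_num)] at this
    convert this using 4
    norm_num
  have hQle : ENNReal.ofReal (9 / 10 * (δ * r) ^ n) * ω ≤ μH[n] Q := by
    have := hy.2 r hr0 (by linarith)
    rw [hball, ← mul_assoc, ← ENNReal.ofReal_mul (by norm_num)] at this
    convert this using 4
    norm_num
  have hQm : MeasurableSet Q := (isClosed_closedBall.inter
    ((hK.inter_left isClosed_closedBall).image hφ).isClosed).measurableSet
  have hunion : μH[n] (P ∪ Q) ≤ ENNReal.ofReal (11 / 10 * (δ * r) ^ n) * ω := by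
    have hsub : P ∪ Q ⊆ closedBall (φ x) (δ * r * (1 + 3 * κ / δ)) := by
      have hmul : δ * r * (1 + 3 * κ / δ) = δ * r + κ * dist x y := by
        rw [hr]
        field_simp
      refine union_subset (inter_subset_left.trans (closedBall_subset_closedBall ?_))
        (inter_subset_left.trans (closedBall_subset_closedBall' ?_))
      · rw [hmul]
        linarith [mul_pos hκ0 hd]
      · rw [hmul, dist_comm (φ y)]
        linarith
    refine (measure_mono hsub).trans ?_
    rw [hausdorffMeasure_closedBall _ (by positivity), mul_pow, mul_comm ((δ * r) ^ n)]
    gcongr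
  have hinter : μH[n] (P ∩ Q) ≤ ENNReal.ofReal (1 / 10 * (δ * r) ^ n) * ω := by
    have hsub : P ∩ Q ⊆ φ '' (collapseSet K φ s ∩ closedBall x r) := by
      rintro _ ⟨⟨-, u, ⟨hu, huK⟩, rfl⟩, -, v, ⟨hv, hvK⟩, hvu⟩
      refine ⟨u, ⟨⟨huK, v, hvK, ?_, ?_, hvu.symm⟩, hu⟩, rfl⟩
      · rintro rfl
        have := dist_triangle_left x y u
        linarith [mem_closedBall.1 hu, mem_closedBall.1 hv]
      · have := dist_triangle4 u x y v
        rw [dist_comm y v] at this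
        linarith [mem_closedBall.1 hu, mem_closedBall.1 hv]
    refine (measure_mono hsub).trans ((hr₀s ⟨hr0, by linarith⟩).trans_eq ?_)
    rw [mul_right_comm, ← ENNReal.ofReal_mul (by positivity), mul_pow, mul_assoc]
  have hsum := measure_union_add_inter (μ := (μH[n] : Measure (EuclideanSpace ℝ (Fin n)))) P hQm
  have hfinal := (add_le_add hPle hQle).trans (hsum.symm.le.trans (add_le_add hunion hinter))
  have hpos : 0 < (δ * r) ^ n := by positivity
  rw [← add_mul, ← add_mul, ← ENNReal.ofReal_add (by positivity) (by positivity),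
    ← ENNReal.ofReal_add (by positivity) (by positivity),
    ENNReal.mul_le_mul_iff_left hausdorffMeasure_unit_ne_zero hausdorffMeasure_unit_ne_top,
    ENNReal.ofReal_le_ofReal_iff (by positivity)] at hfinal
  linarith

/-- Almost every point of `DC(δ, 1/10, R)` is a point near which the chart is bounded below on
`DC(δ, 1/10, R)`. -/
theorem measure_DCset_not_exists_dist_le [TopologicalSpace.SeparableSpace X] [BorelSpace X]
    [IsFiniteMeasure μ] (hC : 0 < C) (hRK : 0 < RK) (hK : IsCompact K)
    (hreg : BallRegular μ K n C RK) {φ : X → EuclideanSpace ℝ (Fin n)} (hφ : LipschitzWith 1 φ)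
    {δ R : ℝ} (hδ : 0 < δ) (hR : 0 < R) :
    μ {x ∈ DCset K φ δ (1 / 10) R | ¬ ∃ j : ℕ, ∀ y ∈ DCset K φ δ (1 / 10) R,
      dist x y < 1 / ((j : ℝ) + 1) → 1 / ((j : ℝ) + 1) * dist x y ≤ dist (φ x) (φ y)} = 0 := by
  set ω := μH[n] (closedBall (0 : EuclideanSpace ℝ (Fin n)) 1) with hω
  set Z : ℕ → Set X := fun m => collapseSet K φ (1 / ((m : ℝ) + 1)) with hZ
  have hZm : ∀ m, MeasurableSet (Z m) := fun m => measurableSet_collapseSet hK hφ.continuous _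
  have hZK : ∀ m, Z m ⊆ K := fun m u hu => hu.1
  set B := ⋂ m, Z m with hB
  have hBm : MeasurableSet B := MeasurableSet.iInter hZm
  obtain ⟨c, hc, himg⟩ := exists_hausdorffMeasure_image_le hC hRK hreg hφ
  have hB0 : μH[n] (φ '' B) = 0 :=
    hausdorffMeasure_image_iInter_collapseSet hK.measurableSet hc himg
  have hθ : ENNReal.ofReal (1 / 10 * δ ^ n) * ω ≠ 0 :=
    mul_ne_zero (by simpa using pow_pos hδ n) hausdorffMeasure_unit_ne_zero
  have hnull := measure_union_null (measure_iUnion_null fun m =>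
      measure_not_eventually_small_image hC hRK hreg hφ (hZK m) (hZm m) hθ)
    (measure_not_eventually_small_image hC hRK hreg hφ (sdiff_subset (s := K) (t := B))
      (hK.measurableSet.diff hBm) hθ)
  refine measure_mono_null ?_ hnull
  rintro x ⟨hx, hnot⟩
  by_cases hxB : x ∈ B
  · refine Or.inr ⟨⟨hx.1, fun h => h.2 hxB⟩, fun hev => ?_⟩
    have hev' : ∀ᶠ r in 𝓝[>] (0 : ℝ), r ∈ Ioo 0 R := Ioo_mem_nhdsGT hR
    obtain ⟨r, hr, hr0, hrR⟩ := (hev.and hev').exists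
    have hle : ENNReal.ofReal (9 / 10 * (δ * r) ^ n) * ω ≤
        ENNReal.ofReal (1 / 10 * (δ * r) ^ n) * ω := by
      have hdc := hx.2 r hr0 hrR
      rw [hausdorffMeasure_closedBall _ (by positivity), ← mul_assoc,
        ← ENNReal.ofReal_mul (by norm_num)] at hdc
      calc ENNReal.ofReal (9 / 10 * (δ * r) ^ n) * ω
          = ENNReal.ofReal ((1 - 1 / 10) * (δ * r) ^ n) * ω := by norm_num
        _ ≤ μH[n] (closedBall (φ x) (δ * r) ∩ φ '' (closedBall x r ∩ K)) := hdc
        _ ≤ μH[n] (φ '' B ∪ φ '' (K \ B ∩ closedBall x r)) := by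
            refine measure_mono ?_
            rintro _ ⟨-, u, ⟨hu, huK⟩, rfl⟩
            by_cases huB : u ∈ B
            · exact Or.inl ⟨u, huB, rfl⟩
            · exact Or.inr ⟨u, ⟨⟨huK, huB⟩, hu⟩, rfl⟩
        _ ≤ 0 + ENNReal.ofReal (1 / 10 * δ ^ n) * ω * ENNReal.ofReal (r ^ n) :=
            (measure_union_le _ _).trans (add_le_add hB0.le hr)
        _ = ENNReal.ofReal (1 / 10 * (δ * r) ^ n) * ω := by
            rw [zero_add, mul_right_comm, ← ENNReal.ofReal_mul (by positivity), mul_pow,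
              mul_assoc]
    have hpos : 0 < (δ * r) ^ n := by positivity
    rw [ENNReal.mul_le_mul_iff_left hausdorffMeasure_unit_ne_zero hausdorffMeasure_unit_ne_top,
      ENNReal.ofReal_le_ofReal_iff (by positivity)] at hle
    linarith
  · obtain ⟨m, hm⟩ : ∃ m, x ∉ Z m := by simpa [hB] using hxB
    refine Or.inl (mem_iUnion.2 ⟨m, ⟨hx.1, hm⟩, fun hev => hnot ?_⟩)
    exact exists_dist_le_of_mem_DCset hK hφ.continuous hδ hR (by positivity) hx hev

/-- The points of a cube at zero distance from its complement form a null subset of `K`. -/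
theorem CubeSystem.measure_boundary [IsFiniteMeasure μ] (hη₀ : 0 < η₀)
    (D : CubeSystem X μ K n C RK a η₀) {Q : Set X} (hQ : IsCube D Q) :
    μ {x | x ∈ Q ∩ K ∧ infDist x Qᶜ ≤ 0} = 0 := by
  obtain ⟨k, hk, hQk⟩ := hQ
  have hlim : Tendsto (fun t : ℝ => ENNReal.ofReal (a * t ^ η₀) * μ Q) (𝓝[>] 0) (𝓝 0) := by
    have h1 : Tendsto (fun t : ℝ => a * t ^ η₀) (𝓝 0) (𝓝 (a * 0 ^ η₀)) :=
      ((Real.continuous_rpow_const hη₀.le).tendsto 0).const_mul a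
    rw [Real.zero_rpow hη₀.ne', mul_zero] at h1
    have h2 := ENNReal.Tendsto.mul_const (ENNReal.tendsto_ofReal h1)
      (Or.inr (measure_ne_top μ Q))
    rw [ENNReal.ofReal_zero, zero_mul] at h2
    exact h2.mono_left nhdsWithin_le_nhds
  refine le_antisymm (ge_of_tendsto hlim ?_) zero_le
  filter_upwards [self_mem_nhdsWithin] with t ht
  refine (measure_mono ?_).trans (D.smallBoundary k hk Q hQk t ht)
  rintro x ⟨hx, h0⟩
  have ht : 0 < t := ht
  exact ⟨hx, h0.trans (by positivity)⟩

/-- A subset of a compact set on which the chart is bounded below at a fixed scale has its closure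
covered by finitely many compact sets on which the chart is biLipschitz. -/
theorem exists_biLipschitz_cover {Y : Type} [MetricSpace Y] {K : Set Y} (hK : IsCompact K)
    {φ : Y → EuclideanSpace ℝ (Fin n)} (hφ : LipschitzWith 1 φ) {E : Set Y} (hEK : E ⊆ K) {κ : ℝ} (hκ : 0 < κ) (hκ1 : κ ≤ 1)
    (hE : ∀ x ∈ E, ∀ y ∈ E, dist x y < κ → κ * dist x y ≤ dist (φ x) (φ y)) :
    ∃ (M : ℕ) (F : Fin M → Set Y),
      (∀ j, IsCompact (F j) ∧ F j ⊆ closure E ∧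
        ∃ L : ℝ, 1 ≤ L ∧ ∀ x ∈ F j, ∀ y ∈ F j,
          L⁻¹ * dist x y ≤ dist (φ x) (φ y) ∧ dist (φ x) (φ y) ≤ L * dist x y) ∧
      closure E ⊆ ⋃ j, F j := by
  obtain ⟨t, ht, hKt⟩ := Metric.totallyBounded_iff.1 hK.totallyBounded (κ / 2) (by positivity)
  have := ht.to_subtype
  obtain ⟨M, ⟨e⟩⟩ := Finite.exists_equiv_fin t
  let F : Fin M → Set Y := fun j => closure (E ∩ ball (e.symm j : Y) (κ / 2))
  have hFE : ∀ j, F j ⊆ closure E := fun j => closure_mono inter_subset_left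
  refine ⟨M, F, fun j => ⟨?_, hFE j, κ⁻¹, (one_le_inv₀ hκ).2 hκ1, ?_⟩, ?_⟩
  · exact hK.of_isClosed_subset isClosed_closure
      ((hFE j).trans (closure_minimal hEK hK.isClosed))
  · intro x hx y hy
    rw [inv_inv]
    constructor
    · have hcl : IsClosed {p : Y × Y | κ * dist p.1 p.2 ≤ dist (φ p.1) (φ p.2)} :=
        isClosed_le (continuous_const.mul continuous_dist)
          ((hφ.continuous.comp continuous_fst).dist (hφ.continuous.comp continuous_snd))
      have hmem : (x, y) ∈ closure
          ((E ∩ ball (e.symm j : Y) (κ / 2)) ×ˢ (E ∩ ball (e.symm j : Y) (κ / 2))) := by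
        rw [closure_prod_eq]
        exact ⟨hx, hy⟩
      refine closure_minimal ?_ hcl hmem
      rintro ⟨u, v⟩ ⟨⟨hu, hub⟩, hv, hvb⟩
      refine hE u hu v hv ((dist_triangle_right u v (e.symm j : Y)).trans_lt ?_)
      linarith [mem_ball.1 hub, mem_ball.1 hvb]
    · have h1 : dist (φ x) (φ y) ≤ dist x y := by simpa using hφ.dist_le_mul x y
      exact h1.trans (le_mul_of_one_le_left dist_nonneg ((one_le_inv₀ hκ).2 hκ1))
  · refine closure_minimal ?_ (isClosed_iUnion_of_finite fun j => isClosed_closure)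
    intro x hx
    obtain ⟨z, hz, hxz⟩ := mem_iUnion₂.1 (hKt (hEK hx))
    refine mem_iUnion.2 ⟨e ⟨z, hz⟩, subset_closure ⟨hx, ?_⟩⟩
    simpa using hxz

theorem local_biLipschitz_decomposition (n : ℕ) (C a η₀ : ℝ) (hC : 1 < C) (ha : 0 < a)
    (hη₀ : 0 < η₀) (δ η c : ℝ) (hδ : 0 < δ) (hη : 0 < η) (hc : 0 < c) :
    ∃ Cst : ℝ, 0 < Cst ∧
      ∀ (X : Type) [MetricSpace X] [CompleteSpace X] [TopologicalSpace.SeparableSpace X]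
        [MeasurableSpace X] [BorelSpace X],
      ∀ (μ : Measure X) [IsFiniteMeasure μ],
      ∀ (K : Set X) (RK : ℝ), IsCompact K → 0 < RK →
      (∀ x ∈ K, ∀ r : ℝ, 0 < r → r < RK →
        ENNReal.ofReal (C⁻¹ * r ^ n) ≤ μ (closedBall x r) ∧
          μ (closedBall x r) ≤ ENNReal.ofReal (C * r ^ n)) →
      ∀ (D : CubeSystem X μ K n C RK a η₀) (φ : X → EuclideanSpace ℝ (Fin n)),
        LipschitzWith 1 φ →
      -- `c` is the constant of the `SI`-volume bound:
      (∃ C₂ : ℝ, 0 < C₂ ∧ ∀ δ' : ℝ, 0 < δ' → ∀ ε' : ℝ, 0 < ε' → ε' < 1 / 2 →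
        ∀ Q : Set X, IsCube D Q →
          μ (⋃₀ SIset D φ (c * δ' ^ n) Q) ≤
            ENNReal.ofReal C₂ * μ (Q \ DCset K φ δ' ε' (16 * (16 : ℝ) ^ lvl D Q))) →
      ∀ Q₀ : Set X, IsCube D Q₀ →
      ∀ ε : ℝ, 0 < ε →
      0 < μ ((Q₀ ∩ K) \ (⋃₀ SIset D φ (c * δ ^ n) Q₀ ∪ (K ∩ ⋃₀ LDset D η Q₀))) →
      ∃ (M : ℕ) (F : Fin M → Set X),
        (∀ j, IsCompact (F j) ∧ F j ⊆ Q₀ ∩ K ∧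
          ∃ L : ℝ, 1 ≤ L ∧ ∀ x ∈ F j, ∀ y ∈ F j,
            L⁻¹ * dist x y ≤ dist (φ x) (φ y) ∧ dist (φ x) (φ y) ≤ L * dist x y) ∧
        μ ((Q₀ ∩ K) \ ⋃ j, F j) ≤
          ENNReal.ofReal ε + ENNReal.ofReal η * μ Q₀ +
            ENNReal.ofReal Cst *
              μ (Q₀ \ DCset K φ δ (1 / 10) (16 * (16 : ℝ) ^ lvl D Q₀)) := by
  refine ⟨1, one_pos, ?_⟩
  intro X _ _ _ _ _ μ _ K RK hK hRK hreg D φ hφ _ Q₀ hQ₀ ε hε _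
  set R : ℝ := 16 * (16 : ℝ) ^ lvl D Q₀ with hR
  have hRpos : 0 < R := by positivity
  have hC0 : 0 < C := one_pos.trans hC
  set G := DCset K φ δ (1 / 10) R with hG
  let κ : ℕ → ℝ := fun j => 1 / ((j : ℝ) + 1)
  have hκ0 : ∀ j, 0 < κ j := fun j => Nat.one_div_pos_of_nat
  have hκm : Antitone κ := fun i j hij => Nat.one_div_le_one_div hij
  let E : ℕ → Set X := fun j => {x | x ∈ G ∧ κ j ≤ infDist x Q₀ᶜ ∧
    ∀ y ∈ G, dist x y < κ j → κ j * dist x y ≤ dist (φ x) (φ y)}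
  have hEm : Monotone E := by
    rintro i j hij x ⟨hx, hd, hl⟩
    refine ⟨hx, (hκm hij).trans hd, fun y hy hxy => ?_⟩
    exact (mul_le_mul_of_nonneg_right (hκm hij) dist_nonneg).trans
      (hl y hy (hxy.trans_le (hκm hij)))
  have hEK : ∀ j, E j ⊆ K := fun j x hx => hx.1.1
  let U : Set X := {x | 0 < infDist x Q₀ᶜ}
  have hUm : MeasurableSet U := (isOpen_lt continuous_const (continuous_infDist_pt _)).measurableSet
  have hUQ : U ⊆ Q₀ := by
    intro x hx
    by_contra hxQ
    exact hx.ne' (infDist_zero_of_mem hxQ)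
  have hclQ : ∀ j, closure (E j) ⊆ Q₀ ∩ K := by
    intro j
    refine subset_inter ?_ (closure_minimal (hEK j) hK.isClosed)
    have hcl : IsClosed {x | κ j ≤ infDist x Q₀ᶜ} :=
      isClosed_le continuous_const (continuous_infDist_pt _)
    exact fun x hx => hUQ ((hκ0 j).trans_le (closure_minimal (fun y hy => hy.2.1) hcl hx))
  have hlim : Tendsto (fun j => μ ((K ∩ U) \ closure (E j))) atTop
      (𝓝 (μ (⋂ j, (K ∩ U) \ closure (E j)))) := by
    refine tendsto_measure_iInter_atTop (fun j => ?_) (fun i j hij => ?_)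
      ⟨0, measure_ne_top _ _⟩
    · exact ((hK.measurableSet.inter hUm).diff isClosed_closure.measurableSet).nullMeasurableSet
    · exact sdiff_subset_sdiff_right (closure_mono (hEm hij))
  have hrest : μ (⋂ j, (K ∩ U) \ closure (E j)) ≤ μ (Q₀ \ G) := by
    have hsub : (⋂ j, (K ∩ U) \ closure (E j)) ⊆ (Q₀ \ G) ∪ {x ∈ G | ¬ ∃ j : ℕ, ∀ y ∈ G,
        dist x y < 1 / ((j : ℝ) + 1) → 1 / ((j : ℝ) + 1) * dist x y ≤ dist (φ x) (φ y)} := by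
      intro x hx
      rw [mem_iInter] at hx
      have hxU : x ∈ U := (hx 0).1.2
      by_cases hxG : x ∈ G
      · refine Or.inr ⟨hxG, ?_⟩
        rintro ⟨i, hi⟩
        obtain ⟨m, hm⟩ := exists_nat_one_div_lt (show 0 < infDist x Q₀ᶜ from hxU)
        refine (hx (max i m)).2 (subset_closure ⟨hxG, ?_, fun y hy hxy => ?_⟩)
        · exact (hκm (le_max_right i m)).trans hm.le
        · exact (mul_le_mul_of_nonneg_right (hκm (le_max_left i m)) dist_nonneg).trans
            (hi y hy (hxy.trans_le (hκm (le_max_left i m))))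
      · exact Or.inl ⟨hUQ hxU, hxG⟩
    refine (measure_mono hsub).trans ((measure_union_le _ _).trans ?_)
    rw [measure_DCset_not_exists_dist_le hC0 hRK hK hreg hφ hδ hRpos, add_zero]
  have hlt : μ (⋂ j, (K ∩ U) \ closure (E j)) < μ (Q₀ \ G) + ENNReal.ofReal ε :=
    hrest.trans_lt (ENNReal.lt_add_right (measure_ne_top _ _) (by simpa using hε))
  obtain ⟨j, hj⟩ := (hlim.eventually_lt_const hlt).exists
  obtain ⟨M, F, hF, hcov⟩ := exists_biLipschitz_cover hK hφ (hEK j) (hκ0 j)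
    ((hκm (Nat.zero_le j)).trans (by simp [κ])) fun x hx y hy => hx.2.2 y hy.1
  refine ⟨M, F, fun i => ⟨(hF i).1, (hF i).2.1.trans (hclQ j), (hF i).2.2⟩, ?_⟩
  have hsub : (Q₀ ∩ K) \ ⋃ i, F i ⊆
      {x | x ∈ Q₀ ∩ K ∧ infDist x Q₀ᶜ ≤ 0} ∪ ((K ∩ U) \ closure (E j)) := by
    rintro x ⟨hx, hxF⟩
    by_cases hxU : x ∈ U
    · exact Or.inr ⟨⟨hx.2, hxU⟩, fun h => hxF (hcov h)⟩
    · exact Or.inl ⟨hx, not_lt.1 hxU⟩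
  calc μ ((Q₀ ∩ K) \ ⋃ i, F i) ≤ 0 + (μ (Q₀ \ G) + ENNReal.ofReal ε) :=
        (measure_mono hsub).trans ((measure_union_le _ _).trans
          (add_le_add (D.measure_boundary hη₀ hQ₀).le hj.le))
    _ = ENNReal.ofReal ε + 0 + ENNReal.ofReal 1 * μ (Q₀ \ G) := by
        rw [zero_add, add_zero, ENNReal.ofReal_one, one_mul, add_comm]
    _ ≤ _ := by gcongr; exact zero_le

end
end

section
/- Let A ⊆ K be a bounded measurable set and let ε, λ > 0. Then there exists J ≤ k_K such that for every j ≤ J there is a finite collection of pairwise disjoint cubes Q_1, …, Q_M ∈ Δ_j with μ(A ∖ ⋃_{i=1}^M Q_i) < ε and μ(Q_i ∖ A) < λ μ(Q_i) for each i. -/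
open MeasureTheory Metric Set Filter ENNReal NNReal Topology

noncomputable section

variable {X : Type} [MetricSpace X] [MeasurableSpace X]
  {μ : Measure X} {K : Set X} {n : ℕ} {C RK a η₀ : ℝ}

namespace CubeSystem

lemma disjoint_of_ne (D : CubeSystem X μ K n C RK a η₀) {j : ℤ} (hj : j ≤ D.kK) {Q Q' : Set X}
    (hQ : Q ∈ D.cubes j) (hQ' : Q' ∈ D.cubes j) (hne : Q ≠ Q') : Disjoint Q Q' := by
  rcases D.nested j j le_rfl hj Q hQ Q' hQ' with h | h
  · obtain ⟨P, -, hP⟩ := D.ancestor j hj Q hQ j le_rfl hj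
    exact absurd ((hP Q ⟨hQ, subset_rfl⟩).trans (hP Q' ⟨hQ', h⟩).symm) hne
  · exact Set.disjoint_iff_inter_eq_empty.2 h

end CubeSystem

/-- Bounded overlap: in an `n`-regular set, a point lies in boundedly many of the balls obtained
by dilating disjoint balls of equal radius by the factor `256`. -/
lemma card_le_of_mem_closedBall [BorelSpace X] {ι : Type*} (hC : 1 < C)
    (hgrowth : ∀ x ∈ K, ∀ r : ℝ, 0 < r → r < RK →
      ENNReal.ofReal (C⁻¹ * r ^ n) ≤ μ (closedBall x r) ∧
        μ (closedBall x r) ≤ ENNReal.ofReal (C * r ^ n))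
    {r : ℝ} (hr : 0 < r) (hrK : 768 * r < RK) {z : ι → X} (hz : ∀ i, z i ∈ K)
    (hdisj : Pairwise fun i i' ↦ Disjoint (closedBall (z i) r) (closedBall (z i') r))
    (t : Finset ι) (x : X) (hx : ∀ i ∈ t, x ∈ closedBall (z i) (256 * r)) :
    (t.card : ℝ) ≤ C ^ 2 * 768 ^ n := by
  have hC0 : 0 < C := by linarith
  rcases t.eq_empty_or_nonempty with rfl | ⟨i₀, hi₀⟩
  · simp only [Finset.card_empty, Nat.cast_zero]
    positivity
  have hsub : (⋃ i ∈ t, closedBall (z i) r) ⊆ closedBall (z i₀) (768 * r) := by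
    refine iUnion₂_subset fun i hi y hy ↦ ?_
    have h₁ := hx i hi
    have h₂ := hx i₀ hi₀
    rw [mem_closedBall] at *
    have h₃ := dist_triangle y (z i) (z i₀)
    have h₄ := dist_triangle_left (z i) (z i₀) x
    linarith
  have hsum : (t.card : ℝ≥0∞) * ENNReal.ofReal (C⁻¹ * r ^ n) ≤
      ENNReal.ofReal (C * (768 * r) ^ n) :=
    calc (t.card : ℝ≥0∞) * ENNReal.ofReal (C⁻¹ * r ^ n)
        = ∑ i ∈ t, ENNReal.ofReal (C⁻¹ * r ^ n) := by simp
      _ ≤ ∑ i ∈ t, μ (closedBall (z i) r) :=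
          Finset.sum_le_sum fun i _ ↦ (hgrowth _ (hz i) r hr (by linarith)).1
      _ = μ (⋃ i ∈ t, closedBall (z i) r) :=
          (measure_biUnion_finset (fun i _ i' _ h ↦ hdisj h)
            fun _ _ ↦ isClosed_closedBall.measurableSet).symm
      _ ≤ μ (closedBall (z i₀) (768 * r)) := measure_mono hsub
      _ ≤ _ := (hgrowth _ (hz i₀) _ (by positivity) hrK).2
  rw [← ENNReal.ofReal_natCast, ← ENNReal.ofReal_mul (by positivity),
    ENNReal.ofReal_le_ofReal_iff (by positivity), mul_pow] at hsum
  have hrn : 0 < r ^ n := by positivity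
  have key : (t.card : ℝ) * C⁻¹ ≤ C * 768 ^ n :=
    le_of_mul_le_mul_right (by linarith) hrn
  calc (t.card : ℝ) = (t.card : ℝ) * C⁻¹ * C := by field_simp
    _ ≤ C * 768 ^ n * C := by gcongr
    _ = C ^ 2 * 768 ^ n := by ring

lemma sum_measure_inter_le_of_card_le {α ι : Type*} [MeasurableSpace α] {ν : Measure α}
    (s : Finset ι) {B : ι → Set α} (hB : ∀ i, MeasurableSet (B i)) {N : ℝ}
    (hN : ∀ t ⊆ s, ∀ x, (∀ i ∈ t, x ∈ B i) → (t.card : ℝ) ≤ N) (V : Set α) :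
    ∑ i ∈ s, ν (B i ∩ V) ≤ ENNReal.ofReal N * ν V := by
  classical
  calc ∑ i ∈ s, ν (B i ∩ V)
      = ∑ i ∈ s, ∫⁻ x in V, (B i).indicator 1 x ∂ν := by
        refine Finset.sum_congr rfl fun i _ ↦ ?_
        rw [lintegral_indicator_one (hB i), Measure.restrict_apply (hB i)]
    _ = ∫⁻ x in V, ∑ i ∈ s, (B i).indicator 1 x ∂ν :=
        (lintegral_finsetSum _ fun i _ ↦ measurable_one.indicator (hB i)).symm
    _ ≤ ∫⁻ _ in V, ENNReal.ofReal N ∂ν := by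
        refine lintegral_mono fun x ↦ ?_
        have h := hN (s.filter fun i ↦ x ∈ B i) (Finset.filter_subset _ _) x
          fun i hi ↦ (Finset.mem_filter.1 hi).2
        simp only [Set.indicator_apply, Pi.one_apply, Finset.sum_boole]
        rw [← ENNReal.ofReal_natCast]
        exact ENNReal.ofReal_le_ofReal h
    _ = ENNReal.ofReal N * ν V := by simp

theorem cube_approximation_of_sets
    {X : Type} [MetricSpace X] [CompleteSpace X] [TopologicalSpace.SeparableSpace X]
    [MeasurableSpace X] [BorelSpace X]
    (μ : Measure X) [IsFiniteMeasure μ] (n : ℕ) (C RK a η₀ : ℝ)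
    (K : Set X) (hK : IsCompact K) (hC : 1 < C) (hRK : 0 < RK)
    (hgrowth : ∀ x ∈ K, ∀ r : ℝ, 0 < r → r < RK →
      ENNReal.ofReal (C⁻¹ * r ^ n) ≤ μ (closedBall x r) ∧
        μ (closedBall x r) ≤ ENNReal.ofReal (C * r ^ n))
    (D : CubeSystem X μ K n C RK a η₀)
    (A : Set X) (hAK : A ⊆ K) (hAb : Bornology.IsBounded A) (hAm : MeasurableSet A)
    (ε lam : ℝ) (hε : 0 < ε) (hlam : 0 < lam) :
    ∃ J : ℤ, J ≤ D.kK ∧ ∀ j : ℤ, j ≤ J →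
      ∃ (M : ℕ) (Q : Fin M → Set X),
        (∀ i, Q i ∈ D.cubes j) ∧
        (∀ i i', i ≠ i' → Disjoint (Q i) (Q i')) ∧
        μ (A \ ⋃ i, Q i) < ENNReal.ofReal ε ∧
        ∀ i, μ (Q i \ A) < ENNReal.ofReal lam * μ (Q i) := by
  have hC0 : 0 < C := by linarith
  set N : ℝ := C ^ 2 * 768 ^ n
  have hN0 : 0 < N := by positivity
  obtain ⟨F, hFA, hFc, hAF⟩ := hAm.exists_isClosed_sdiff_lt (μ := μ) (measure_ne_top μ A)
    (ENNReal.ofReal_pos.2 (half_pos hε)).ne'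
  obtain ⟨U, hAU, hUo, -, hUA⟩ := hAm.exists_isOpen_sdiff_lt (μ := μ) (measure_ne_top μ A)
    (ENNReal.ofReal_pos.2 (show 0 < lam * (ε / 2) / N by positivity)).ne'
  have hFK : IsCompact F := hK.of_isClosed_subset hFc (hFA.trans hAK)
  obtain ⟨δ, hδ, hδU⟩ := hFK.exists_cthickening_subset_open hUo (hFA.trans hAU)
  obtain ⟨m, hm⟩ := exists_pow_lt_of_lt_one (show 0 < δ / 32 by positivity)
    (show (1 / 16 : ℝ) < 1 by norm_num)
  refine ⟨min D.kK (-m), min_le_left _ _, fun j hj ↦ ?_⟩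
  have hjK : j ≤ D.kK := hj.trans (min_le_left _ _)
  set r : ℝ := (16 : ℝ) ^ (j - 1) with hr
  have hr0 : 0 < r := by positivity
  have hR : (16 : ℝ) ^ (j + 1) = 256 * r := by
    rw [hr, show j + 1 = (j - 1) + 2 by ring, zpow_add₀ (by norm_num)]
    norm_num [mul_comm]
  have hrK : 768 * r < RK := by
    have h₁ : (16 : ℝ) ^ (j + 2) = 4096 * r := by
      rw [hr, show j + 2 = (j - 1) + 3 by ring, zpow_add₀ (by norm_num)]
      norm_num [mul_comm]
    have h₂ : (16 : ℝ) ^ (j + 2) ≤ 16 ^ (D.kK + 2) :=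
      zpow_le_zpow_right₀ (by norm_num) (by linarith)
    linarith [D.size]
  have hrδ : 512 * r ≤ δ := by
    have h₁ : (16 : ℝ) ^ j = 16 * r := by
      rw [hr, show j = (j - 1) + 1 by ring, zpow_add₀ (by norm_num)]
      norm_num [mul_comm]
    have h₂ : (16 : ℝ) ^ j ≤ 16 ^ (-m : ℤ) :=
      zpow_le_zpow_right₀ (by norm_num) (hj.trans (min_le_right _ _))
    rw [zpow_neg, zpow_natCast, ← inv_pow, ← one_div] at h₂
    linarith
  choose z hzK hzr hzR using fun Q : D.cubes j ↦ D.ball j hjK Q Q.2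
  simp only [hR] at hzR
  have hdisj : Pairwise fun P P' ↦ Disjoint (closedBall (z P) r) (closedBall (z P') r) :=
    fun P P' h ↦ (D.disjoint_of_ne hjK P.2 P'.2 (Subtype.coe_injective.ne h)).mono
      (hzr P) (hzr P')
  have hfin : Finite (D.cubes j) := by
    have h := Measure.finite_const_le_meas_of_disjoint_iUnion μ
      (ENNReal.ofReal_pos.2 (show 0 < C⁻¹ * r ^ n by positivity))
      (fun P ↦ (isClosed_closedBall (x := z P) (ε := r)).measurableSet) hdisj
      (measure_ne_top μ _)
    refine Set.finite_univ_iff.1 (h.subset fun P _ ↦ ?_)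
    exact (hgrowth _ (hzK P) r hr0 (by linarith)).1
  classical
  have := Fintype.ofFinite (D.cubes j)
  let good : Finset (D.cubes j) :=
    Finset.univ.filter fun P ↦ μ ((P : Set X) \ A) < ENNReal.ofReal lam * μ (P : Set X)
  let bad : Finset (D.cubes j) := Finset.univ.filter fun P ↦
    ENNReal.ofReal lam * μ (P : Set X) ≤ μ ((P : Set X) \ A) ∧ ((P : Set X) ∩ F).Nonempty
  have hbadU : ∀ P ∈ bad, (P : Set X) ⊆ U := by
    intro P hP y hy
    obtain ⟨w, hwP, hwF⟩ := (Finset.mem_filter.1 hP).2.2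
    refine hδU (mem_cthickening_of_dist_le y w δ F hwF ?_)
    have h₁ := mem_closedBall.1 (hzR P hy)
    have h₂ := mem_closedBall.1 (hzR P hwP)
    linarith [dist_triangle_right y w (z P)]
  have hbad : ∑ P ∈ bad, μ (P : Set X) ≤ ENNReal.ofReal (ε / 2) := by
    have h : ENNReal.ofReal lam * ∑ P ∈ bad, μ (P : Set X) ≤
        ENNReal.ofReal lam * ENNReal.ofReal (ε / 2) :=
      calc ENNReal.ofReal lam * ∑ P ∈ bad, μ (P : Set X)
          = ∑ P ∈ bad, ENNReal.ofReal lam * μ (P : Set X) := Finset.mul_sum _ _ _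
        _ ≤ ∑ P ∈ bad, μ (closedBall (z P) (256 * r) ∩ (U \ A)) :=
            Finset.sum_le_sum fun P hP ↦ (Finset.mem_filter.1 hP).2.1.trans <|
              measure_mono fun y hy ↦ ⟨hzR P hy.1, hbadU P hP hy.1, hy.2⟩
        _ ≤ ENNReal.ofReal N * μ (U \ A) :=
            sum_measure_inter_le_of_card_le bad (fun P ↦ isClosed_closedBall.measurableSet)
              (fun t _ x hx ↦
                card_le_of_mem_closedBall hC hgrowth hr0 hrK hzK hdisj t x hx) _
        _ ≤ ENNReal.ofReal N * ENNReal.ofReal (lam * (ε / 2) / N) := by gcongr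
        _ = ENNReal.ofReal lam * ENNReal.ofReal (ε / 2) := by
            rw [← ENNReal.ofReal_mul hN0.le, ← ENNReal.ofReal_mul hlam.le,
              mul_div_cancel₀ _ hN0.ne']
    exact (ENNReal.mul_le_mul_iff_right (ENNReal.ofReal_pos.2 hlam).ne'
      ENNReal.ofReal_ne_top).1 h
  refine ⟨good.card, fun i ↦ (good.equivFin.symm i : D.cubes j), fun i ↦ Subtype.coe_prop _,
    fun i i' h ↦ ?_, ?_, fun i ↦ (Finset.mem_filter.1 (good.equivFin.symm i).2).2⟩
  · exact D.disjoint_of_ne hjK (Subtype.coe_prop _) (Subtype.coe_prop _) fun h' ↦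
      h (good.equivFin.symm.injective (Subtype.ext (Subtype.ext h')))
  have hsub : A \ ⋃ i, ((good.equivFin.symm i : D.cubes j) : Set X) ⊆
      ((A \ F) ∪ (K \ ⋃₀ D.cubes j)) ∪ ⋃ P ∈ bad, (P : Set X) := by
    rintro x ⟨hxA, hx⟩
    by_cases hxF : x ∈ F
    · by_cases hxc : x ∈ ⋃₀ D.cubes j
      · obtain ⟨Q, hQ, hxQ⟩ := hxc
        refine Or.inr (mem_iUnion₂.2 ⟨⟨Q, hQ⟩, ?_, hxQ⟩)
        refine Finset.mem_filter.2 ⟨Finset.mem_univ _, ?_, x, hxQ, hxF⟩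
        by_contra! hlt
        have hg : (⟨Q, hQ⟩ : D.cubes j) ∈ good := Finset.mem_filter.2 ⟨Finset.mem_univ _, hlt⟩
        exact hx (mem_iUnion.2 ⟨good.equivFin ⟨_, hg⟩, by simpa using hxQ⟩)
      · exact Or.inl (Or.inr ⟨hAK hxA, hxc⟩)
    · exact Or.inl (Or.inl ⟨hxA, hxF⟩)
  calc μ (A \ ⋃ i, ((good.equivFin.symm i : D.cubes j) : Set X))
      ≤ μ (A \ F) + μ (K \ ⋃₀ D.cubes j) + ∑ P ∈ bad, μ (P : Set X) :=
        (measure_mono hsub).trans <| (measure_union_le _ _).trans <|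
          add_le_add (measure_union_le _ _) (measure_biUnion_finset_le _ _)
    _ ≤ μ (A \ F) + ENNReal.ofReal (ε / 2) := by
        rw [D.cover j hjK, add_zero]
        gcongr
    _ < ENNReal.ofReal (ε / 2) + ENNReal.ofReal (ε / 2) :=
        ENNReal.add_lt_add_right ENNReal.ofReal_ne_top hAF
    _ = ENNReal.ofReal ε := by
        rw [← ENNReal.ofReal_add (by positivity) (by positivity), add_halves]

end
end

section
/- Let η > 0 and let F be a family of stopping time regions in Δ that are pairwise disjoint as subsets of Δ. Assume that the collection of top cubes {Q(S) : S ∈ F} is a K-Carleson set with constant C_1 and that μ(Q(S) ∩ K) ≥ η μ(Q(S)) for every S ∈ F. Suppose for each S ∈ F we have a collection of cubes E(S) ⊆ S that is a K-Carleson set with constant C_2. Then E* = ⋃_{S ∈ F} E(S) is a K-Carleson set, with constant depending only on C_1, C_2 and η. -/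
open MeasureTheory Metric Set Filter ENNReal NNReal Topology

noncomputable section

variable {X : Type} [MetricSpace X] [MeasurableSpace X]
  {μ : Measure X} {K : Set X} {n : ℕ} {C RK a η₀ : ℝ}

theorem IsCube.nonempty {D : CubeSystem X μ K n C RK a η₀} {Q : Set X} (hQ : IsCube D Q) :
    Q.Nonempty := by
  obtain ⟨k, hk, hQk⟩ := hQ
  obtain ⟨z, -, hz, -⟩ := D.ball k hk Q hQk
  exact ⟨z, hz (mem_closedBall_self (by positivity))⟩

theorem IsCube.subset_or_subset {D : CubeSystem X μ K n C RK a η₀} {Q R P : Set X}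
    (hQ : IsCube D Q) (hR : IsCube D R) (hP : P.Nonempty) (hPQ : P ⊆ Q) (hPR : P ⊆ R) :
    Q ⊆ R ∨ R ⊆ Q := by
  obtain ⟨j, hj, hQj⟩ := hQ
  obtain ⟨k, hk, hRk⟩ := hR
  obtain ⟨x, hx⟩ := hP
  rcases le_total j k with h | h
  · refine (D.nested j k h hk Q hQj R hRk).imp_right fun h' => ?_
    exact absurd (h' ▸ ⟨hPQ hx, hPR hx⟩ : x ∈ (∅ : Set X)) (notMem_empty x)
  · refine ((D.nested k j h hj R hRk Q hQj).imp_right fun h' => ?_).symm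
    exact absurd (h' ▸ ⟨hPR hx, hPQ hx⟩ : x ∈ (∅ : Set X)) (notMem_empty x)

/-- The part of a Carleson family inside a stopping time region that lies below a cube `Q₀` is
controlled either by the top cube, when it lies in `Q₀`, or by `Q₀`, when it lies in the region. -/
theorem KCarleson.tsum_le_of_subset_region {D : CubeSystem X μ K n C RK a η₀}
    {S E : Set (Set X)} {top Q₀ : Set X} {C₂ : ℝ} (hS : IsSTRegion D S top) (hES : E ⊆ S)
    (hE : KCarleson D E C₂) (hQ₀ : IsCube D Q₀) :
    (∑' Q : ↥{Q | Q ∈ E ∧ Q ⊆ Q₀}, μ ((Q : Set X) ∩ K)) ≤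
      {T | T ⊆ Q₀}.indicator (fun T => ENNReal.ofReal C₂ * μ T) top +
        S.indicator (fun _ => ENNReal.ofReal C₂ * μ Q₀) Q₀ := by
  obtain ⟨htop, hcube, hsub, hcoh⟩ := hS
  rcases eq_empty_or_nonempty {Q | Q ∈ E ∧ Q ⊆ Q₀} with h | ⟨P, hPE, hP⟩
  · simp [h]
  have hPS := hES hPE
  rcases (hcube top htop).subset_or_subset hQ₀ (hcube P hPS).nonempty (hsub P hPS) hP with h | h
  · refine le_add_right ?_
    rw [indicator_of_mem (by exact h)]
    refine le_trans ?_ (hE top (hcube top htop))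
    exact ENNReal.tsum_mono_subtype (fun Q : Set X => μ (Q ∩ K))
      fun Q hQ => ⟨hQ.1, hsub Q (hES hQ.1)⟩
  · refine le_add_left ?_
    rw [indicator_of_mem (hcoh P hPS Q₀ hQ₀ hP h)]
    exact hE Q₀ hQ₀

theorem K_Carleson_union_over_stopping_time_regions (n : ℕ) (C a η₀ : ℝ) (hC : 1 < C)
    (ha : 0 < a) (hη₀ : 0 < η₀) (η C₁ C₂ : ℝ) (hη : 0 < η) (hC₁ : 0 < C₁)
    (hC₂ : 0 < C₂) :
    ∃ C' : ℝ, 0 < C' ∧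
      ∀ (X : Type) [MetricSpace X] [CompleteSpace X] [TopologicalSpace.SeparableSpace X]
        [MeasurableSpace X] [BorelSpace X],
      ∀ (μ : Measure X) [IsFiniteMeasure μ],
      ∀ (K : Set X) (RK : ℝ), IsCompact K → 0 < RK →
      (∀ x ∈ K, ∀ r : ℝ, 0 < r → r < RK →
        ENNReal.ofReal (C⁻¹ * r ^ n) ≤ μ (closedBall x r) ∧
          μ (closedBall x r) ≤ ENNReal.ofReal (C * r ^ n)) →
      ∀ D : CubeSystem X μ K n C RK a η₀,
      ∀ (ι : Type) (S : ι → Set (Set X)) (top : ι → Set X) (E : ι → Set (Set X)),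
        (∀ i, IsSTRegion D (S i) (top i)) →
        (∀ i j, i ≠ j → Disjoint (S i) (S j)) →
        KCarleson D (Set.range top) C₁ →
        (∀ i, ENNReal.ofReal η * μ (top i) ≤ μ (top i ∩ K)) →
        (∀ i, E i ⊆ S i) →
        (∀ i, KCarleson D (E i) C₂) →
        KCarleson D (⋃ i, E i) C' := by
  refine ⟨C₂ / η * C₁ + C₂, by positivity, ?_⟩
  intro X _ _ _ _ _ μ _ K RK _ _ _ D ι S top E hS hdisj htop hη_top hES hE Q₀ hQ₀
  have hinj : Function.Injective top := fun i j hij => by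
    by_contra hne
    exact Set.disjoint_left.1 (hdisj i j hne) (hS i).1 (hij ▸ (hS j).1)
  have hunion : {Q | Q ∈ ⋃ i, E i ∧ Q ⊆ Q₀} = ⋃ i, {Q | Q ∈ E i ∧ Q ⊆ Q₀} := by
    ext Q
    simp
  have hdense : ∀ i, ENNReal.ofReal C₂ * μ (top i) ≤
      ENNReal.ofReal (C₂ / η) * μ (top i ∩ K) := fun i => by
    refine le_trans (le_of_eq ?_) (mul_le_mul_right (hη_top i) _)
    rw [← mul_assoc, ← ENNReal.ofReal_mul (by positivity), div_mul_cancel₀ _ hη.ne']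
  have hbelow : ∑' i, {T | T ⊆ Q₀}.indicator (fun T => ENNReal.ofReal C₂ * μ T) (top i) ≤
      ENNReal.ofReal (C₂ / η * C₁) * μ Q₀ := by
    calc ∑' i, {T | T ⊆ Q₀}.indicator (fun T => ENNReal.ofReal C₂ * μ T) (top i)
        ≤ ∑' i, {T | T ∈ range top ∧ T ⊆ Q₀}.indicator
            (fun T => ENNReal.ofReal (C₂ / η) * μ (T ∩ K)) (top i) := by
          refine ENNReal.tsum_le_tsum fun i => ?_
          by_cases h : top i ⊆ Q₀
          · rw [indicator_of_mem (by exact h), indicator_of_mem (by exact ⟨mem_range_self i, h⟩)]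
            exact hdense i
          · rw [indicator_of_notMem (by exact h)]
            exact zero_le
      _ ≤ ∑' T, {T | T ∈ range top ∧ T ⊆ Q₀}.indicator
            (fun T => ENNReal.ofReal (C₂ / η) * μ (T ∩ K)) T :=
          ENNReal.tsum_comp_le_tsum_of_injective hinj _
      _ = ENNReal.ofReal (C₂ / η) *
            ∑' T : ↥{T | T ∈ range top ∧ T ⊆ Q₀}, μ ((T : Set X) ∩ K) := by
          rw [← tsum_subtype, ENNReal.tsum_mul_left]
      _ ≤ ENNReal.ofReal (C₂ / η) * (ENNReal.ofReal C₁ * μ Q₀) :=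
          mul_le_mul_right (htop Q₀ hQ₀) _
      _ = ENNReal.ofReal (C₂ / η * C₁) * μ Q₀ := by
          rw [← mul_assoc, ← ENNReal.ofReal_mul (by positivity)]
  have habove : ∑' i, (S i).indicator (fun _ => ENNReal.ofReal C₂ * μ Q₀) Q₀ ≤
      ENNReal.ofReal C₂ * μ Q₀ := by
    by_cases h : ∃ i, Q₀ ∈ S i
    · obtain ⟨i, hi⟩ := h
      rw [tsum_eq_single i fun j hj => indicator_of_notMem
        (fun hQj => Set.disjoint_left.1 (hdisj j i hj) hQj hi) _]
      exact indicator_le_self _ _ _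
    · rw [not_exists] at h
      rw [ENNReal.tsum_eq_zero.2 fun i => indicator_of_notMem (h i) _]
      exact zero_le
  rw [hunion]
  calc _ ≤ ∑' i, ∑' Q : ↥{Q | Q ∈ E i ∧ Q ⊆ Q₀}, μ ((Q : Set X) ∩ K) :=
        ENNReal.tsum_iUnion_le_tsum (fun Q : Set X => μ (Q ∩ K)) _
    _ ≤ ∑' i, ({T | T ⊆ Q₀}.indicator (fun T => ENNReal.ofReal C₂ * μ T) (top i) +
          (S i).indicator (fun _ => ENNReal.ofReal C₂ * μ Q₀) Q₀) :=
        ENNReal.tsum_le_tsum fun i => (hE i).tsum_le_of_subset_region (hS i) (hES i) hQ₀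
    _ ≤ ENNReal.ofReal (C₂ / η * C₁) * μ Q₀ + ENNReal.ofReal C₂ * μ Q₀ := by
        rw [ENNReal.tsum_add]
        exact add_le_add hbelow habove
    _ = ENNReal.ofReal (C₂ / η * C₁ + C₂) * μ Q₀ := by
        rw [ENNReal.ofReal_add (by positivity) hC₂.le, add_mul]

end
end
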